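/- arXiv:1410.0989 — 2 statements merged into one kernel-verified Lean document; each statement's English description precedes it below -/
import Mathlib

section
/- Let Λ and Λ' be two independent uniformly random subsets of {1,...,p}, each of size d-1, where d ≤ p. Then P(|Λ ∩ Λ'| ≥ (d-1)·(d+p)/(2p)) ≤ exp(-(d-1)(p-d+2)/(2p)). -/
open MeasureTheory Metric Set
open scoped ENNReal NNReal

instance (p : ℕ) : MeasurableSpace (Finset (Fin p)) := ⊤

theorem two_point_mgf_le {q : ℝ} (hq0 : 0 ≤ q) (hq1 : q ≤ 1) (s : ℝ) :
    (1 - q) + q * Real.exp s ≤ Real.exp (q * s + s ^ 2 / 8) := by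
  set μ : Measure ℝ := ENNReal.ofReal (1 - q) • Measure.dirac 0 + ENNReal.ofReal q • Measure.dirac 1
    with hμ
  have : IsProbabilityMeasure μ := ⟨by
    simp [hμ, ← ENNReal.ofReal_add (sub_nonneg.2 hq1) hq0]⟩
  have hint (f : ℝ → ℝ) : ∫ x, f x ∂μ = (1 - q) * f 0 + q * f 1 := by
    rw [hμ, integral_add_measure, integral_smul_measure, integral_smul_measure,
      integral_dirac, integral_dirac, ENNReal.toReal_ofReal (sub_nonneg.2 hq1),
      ENNReal.toReal_ofReal hq0, smul_eq_mul, smul_eq_mul]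
    · exact (integrable_dirac (by simp)).smul_measure ENNReal.ofReal_ne_top
    · exact (integrable_dirac (by simp)).smul_measure ENNReal.ofReal_ne_top
  have hae : ∀ᵐ x ∂μ, id x ∈ Set.Icc (0 : ℝ) 1 := by
    rw [hμ, ae_add_measure_iff]
    exact ⟨Measure.ae_smul_measure (by simp [ae_dirac_eq]) _,
      Measure.ae_smul_measure (by simp [ae_dirac_eq]) _⟩
  have h := (ProbabilityTheory.hasSubgaussianMGF_of_mem_Icc aemeasurable_id hae).mgf_le s
  simp only [ProbabilityTheory.mgf, hint, id] at h
  have hexp : (1 - q) + q * Real.exp s = Real.exp (q * s) *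
      ((1 - q) * Real.exp (s * (0 - ((1 - q) * 0 + q * 1))) +
        q * Real.exp (s * (1 - ((1 - q) * 0 + q * 1)))) := by
    rw [mul_add, mul_left_comm, mul_left_comm _ q, ← Real.exp_add, ← Real.exp_add]
    ring_nf
    simp only [Real.exp_zero]
    ring
  rw [hexp, Real.exp_add]
  refine mul_le_mul_of_nonneg_left (h.trans_eq ?_) (Real.exp_nonneg _)
  congr 1
  simp
  ring

theorem serfling_factor_step {K N : ℝ} (hK : 0 ≤ K) (hKN : K ≤ N) :
    K * (N - K + 1) / N + (1 - K / N) ^ 2 ≤ (K + 1) * (N - K + 1) / (N + 1) := by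
  rcases (hK.trans hKN).eq_or_lt with rfl | hN
  · obtain rfl : K = 0 := le_antisymm hKN hK
    norm_num
  · rw [← sub_nonneg]
    have : (K + 1) * (N - K + 1) / (N + 1) - (K * (N - K + 1) / N + (1 - K / N) ^ 2)
        = (N - K) * K / (N ^ 2 * (N + 1)) := by
      field_simp
      ring
    rw [this]
    exact div_nonneg (mul_nonneg (by linarith) hK) (by positivity)

theorem sum_powersetCard_exp_card_inter_le {α : Type*} [DecidableEq α] (r : ℝ) (A : Finset α) :
    ∀ (S : Finset α) (n : ℕ), A ⊆ S →
      ∑ B ∈ S.powersetCard n, Real.exp (r * ((A ∩ B).card : ℝ)) ≤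
        (S.card.choose n : ℝ) * Real.exp (r * (n * A.card / S.card) +
          r ^ 2 / 8 * (A.card * ((S.card : ℝ) - A.card + 1) / S.card)) := by
  induction A using Finset.induction_on with
  | empty => intro S n _; simp
  | insert a A ha ih =>
    intro S n hAS
    obtain ⟨T, haT, rfl⟩ : ∃ T, a ∉ T ∧ S = insert a T :=
      ⟨S.erase a, by simp, (Finset.insert_erase (hAS (by simp))).symm⟩
    have hAT : A ⊆ T := fun x hx => by
      rcases Finset.mem_insert.1 (hAS (Finset.mem_insert_of_mem hx)) with rfl | h
      · exact absurd hx ha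
      · exact h
    have hcard : (A.card : ℝ) ≤ T.card := by exact_mod_cast Finset.card_le_card hAT
    rw [Finset.card_insert_of_notMem ha, Finset.card_insert_of_notMem haT]
    push_cast
    rcases n with _ | n
    · simp only [Finset.powersetCard_zero, Finset.sum_singleton, Finset.inter_empty]
      simp only [Finset.card_empty, Nat.cast_zero, mul_zero, zero_mul, zero_div, Real.exp_zero,
        Nat.choose_zero_right, Nat.cast_one, one_mul, zero_add]
      refine Real.one_le_exp (mul_nonneg (by positivity) (div_nonneg
        (mul_nonneg (by positivity) (by linarith)) (by positivity)))
    · rcases lt_or_ge T.card n with hlt | hle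
      · rw [Finset.powersetCard_eq_empty.2 (by rw [Finset.card_insert_of_notMem haT]; omega)]
        simp only [Finset.sum_empty]
        positivity
      have hsum : ∑ B ∈ (insert a T).powersetCard (n + 1),
            Real.exp (r * ((insert a A ∩ B).card : ℝ)) =
          ∑ B ∈ T.powersetCard (n + 1), Real.exp (r * ((A ∩ B).card : ℝ)) +
          Real.exp r * ∑ B ∈ T.powersetCard n, Real.exp (r * ((A ∩ B).card : ℝ)) := by
        have hmem {k : ℕ} {B : Finset α} (hB : B ∈ T.powersetCard k) : a ∉ B :=
          fun h => haT ((Finset.mem_powersetCard.1 hB).1 h)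
        rw [Finset.powersetCard_succ_insert haT, Finset.sum_union, Finset.sum_image,
          Finset.mul_sum]
        · congr 1
          · refine Finset.sum_congr rfl fun B hB => ?_
            rw [Finset.insert_inter_of_notMem (hmem hB)]
          · refine Finset.sum_congr rfl fun B hB => ?_
            rw [← Finset.insert_inter_distrib,
              Finset.card_insert_of_notMem (fun h => ha (Finset.mem_inter.1 h).1), ← Real.exp_add]
            push_cast
            ring_nf
        · intro B hB C hC h
          rw [← Finset.erase_insert (hmem hB), ← Finset.erase_insert (hmem hC)]
          exact congrArg (Finset.erase · a) h
        · rw [Finset.disjoint_left]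
          intro B hB hB'
          obtain ⟨C, -, rfl⟩ := Finset.mem_image.1 hB'
          exact hmem hB (Finset.mem_insert_self a C)
      have h₁ := ih T (n + 1) hAT
      have h₂ := ih T n hAT
      have hc₂ : (T.card.choose n : ℝ) = (T.card + 1).choose (n + 1) *
          (((n : ℝ) + 1) / (T.card + 1)) := by
        have := Nat.add_one_mul_choose_eq T.card n
        field_simp
        exact_mod_cast (by linarith)
      have hc₁ : (T.card.choose (n + 1) : ℝ) = (T.card + 1).choose (n + 1) *
          (1 - ((n : ℝ) + 1) / (T.card + 1)) := by
        have := Nat.choose_succ_succ T.card n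
        have h' : ((T.card + 1).choose (n + 1) : ℝ) = T.card.choose n + T.card.choose (n + 1) := by
          exact_mod_cast this
        linarith
      have hstep := serfling_factor_step (Nat.cast_nonneg A.card) hcard
      have htwo := two_point_mgf_le (q := ((n : ℝ) + 1) / (T.card + 1)) (by positivity)
        (by rw [div_le_one (by positivity)]; exact_mod_cast Nat.succ_le_succ hle)
        (r * (1 - A.card / T.card))
      have hlin : ((n : ℝ) + 1) * A.card / T.card +
          ((n : ℝ) + 1) / (T.card + 1) * (1 - A.card / T.card) =
          ((n : ℝ) + 1) * (A.card + 1) / (T.card + 1) := by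
        rcases (Nat.cast_nonneg (α := ℝ) T.card).eq_or_lt with h0 | hpos
        · have hA0 : (A.card : ℝ) = 0 :=
            le_antisymm (hcard.trans_eq h0.symm) (Nat.cast_nonneg _)
          rw [← h0, hA0]
          simp
        · field_simp
          ring
      have hC : (0 : ℝ) ≤ (T.card + 1).choose (n + 1) := Nat.cast_nonneg _
      rw [hsum]
      rw [hc₁] at h₁
      rw [hc₂] at h₂
      push_cast at h₁
      generalize ((T.card + 1).choose (n + 1) : ℝ) = C at *
      generalize (A.card : ℝ) = K at *
      generalize (T.card : ℝ) = N at *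
      generalize hq : ((n : ℝ) + 1) / (N + 1) = q at *
      calc _ ≤ C * (1 - q) * Real.exp (r * ((n + 1) * K / N) + r ^ 2 / 8 * (K * (N - K + 1) / N)) +
            Real.exp r * (C * q *
              Real.exp (r * (n * K / N) + r ^ 2 / 8 * (K * (N - K + 1) / N))) :=
            add_le_add h₁ (mul_le_mul_of_nonneg_left h₂ (Real.exp_nonneg r))
        _ = C * Real.exp (r * ((n + 1) * K / N) + r ^ 2 / 8 * (K * (N - K + 1) / N)) *
            ((1 - q) + q * Real.exp (r * (1 - K / N))) := by
          have : Real.exp r *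
              Real.exp (r * (n * K / N) + r ^ 2 / 8 * (K * (N - K + 1) / N)) =
              Real.exp (r * ((n + 1) * K / N) + r ^ 2 / 8 * (K * (N - K + 1) / N)) *
                Real.exp (r * (1 - K / N)) := by
            rw [← Real.exp_add, ← Real.exp_add]
            ring_nf
          linear_combination C * q * this
        _ ≤ C * Real.exp (r * ((n + 1) * K / N) + r ^ 2 / 8 * (K * (N - K + 1) / N)) *
            Real.exp (q * (r * (1 - K / N)) + (r * (1 - K / N)) ^ 2 / 8) :=
          mul_le_mul_of_nonneg_left htwo (mul_nonneg hC (Real.exp_nonneg _))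
        _ ≤ _ := by
          rw [mul_assoc, ← Real.exp_add]
          refine mul_le_mul_of_nonneg_left (Real.exp_le_exp.2 ?_) hC
          have h := mul_le_mul_of_nonneg_left hstep (show 0 ≤ r ^ 2 / 8 by positivity)
          have hK : (K + 1) * (N + 1 - (K + 1) + 1) / (N + 1) =
              (K + 1) * (N - K + 1) / (N + 1) := by ring
          push_cast
          rw [hK, ← hlin]
          linarith

theorem card_filter_le_card_inter_le {α : Type*} [DecidableEq α] {A S : Finset α} (hAS : A ⊆ S)
    (n : ℕ) {r : ℝ} (hr : 0 ≤ r) (t : ℝ) :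
    (((S.powersetCard n).filter fun B => t ≤ ((A ∩ B).card : ℝ)).card : ℝ) ≤
      (S.card.choose n : ℝ) * Real.exp (r * (n * A.card / S.card) +
        r ^ 2 / 8 * (A.card * ((S.card : ℝ) - A.card + 1) / S.card) - r * t) := by
  rw [Real.exp_sub, ← mul_div_assoc, le_div_iff₀ (Real.exp_pos _)]
  refine le_trans ?_ (sum_powersetCard_exp_card_inter_le r A S n hAS)
  rw [← nsmul_eq_mul]
  refine (Finset.card_nsmul_le_sum _ (fun B => Real.exp (r * ((A ∩ B).card : ℝ))) _
    fun B hB => ?_).trans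
    (Finset.sum_le_sum_of_subset_of_nonneg (Finset.filter_subset _ _)
      fun _ _ _ => Real.exp_nonneg _)
  exact Real.exp_le_exp.2 (mul_le_mul_of_nonneg_left (Finset.mem_filter.1 hB).2 hr)

/-- for `Λ, Λ'` independent uniformly random subsets of `{1,…,p}` of size `d-1`
(with `d ≤ p`), `P(|Λ ∩ Λ'| ≥ (d-1)(d+p)/(2p)) ≤ exp(-(d-1)(p-d+2)/(2p))`. -/
theorem stmt3 (p d : ℕ) (hd : 1 ≤ d) (hdp : d ≤ p)
    (hne : (((Finset.univ : Finset (Fin p)).powersetCard (d - 1)) ×ˢ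
            ((Finset.univ : Finset (Fin p)).powersetCard (d - 1))).Nonempty) :
    (PMF.uniformOfFinset _ hne).toMeasure
      {q : Finset (Fin p) × Finset (Fin p) |
        ((d : ℝ) - 1) * (((d : ℝ) + p) / (2 * p)) ≤ ((q.1 ∩ q.2).card : ℝ)}
      ≤ ENNReal.ofReal (Real.exp (-(((d : ℝ) - 1) * ((p : ℝ) - d + 2)) / (2 * p))) := by
  classical
  obtain ⟨m, rfl⟩ : ∃ m, d = m + 1 := ⟨d - 1, by omega⟩
  have hp : (0 : ℝ) < p := by exact_mod_cast (by omega : 0 < p)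
  have : DiscreteMeasurableSpace (Finset (Fin p)) := ⟨fun _ => trivial⟩
  rw [PMF.toMeasure_uniformOfFinset_apply hne _ (Set.toFinite _).measurableSet]
  simp only [Nat.add_sub_cancel] at hne ⊢
  set s := (Finset.univ : Finset (Fin p)).powersetCard m
  have hs : s.card = p.choose m := by simp [s]
  have hs0 : 0 < (s ×ˢ s).card := Finset.card_pos.2 hne
  rw [← ENNReal.ofReal_natCast, ← ENNReal.ofReal_natCast,
    ← ENNReal.ofReal_div_of_pos (by exact_mod_cast hs0)]
  refine ENNReal.ofReal_le_ofReal ?_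
  rw [div_le_iff₀ (by exact_mod_cast hs0)]
  simp only [Set.mem_ofPred_eq]
  rw [Finset.card_filter, Finset.sum_product, Finset.card_product, Nat.cast_sum, Nat.cast_mul,
    mul_left_comm, ← nsmul_eq_mul]
  refine Finset.sum_le_card_nsmul _ _ _ fun A hA => ?_
  rw [← Finset.card_filter, hs, mul_comm (Real.exp _)]
  refine (card_filter_le_card_inter_le (Finset.subset_univ A) m zero_le_two _).trans_eq ?_
  rw [Finset.card_univ, Fintype.card_fin, (Finset.mem_powersetCard.1 hA).2]
  congr 2
  push_cast
  field_simp
  ring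
end

section
/- Let Ω ∈ ℝ^{p×d} have i.i.d. standard Gaussian entries with p ≥ 2(d-1), and let K₁ be the union of 1-dimensional subspaces {x : Ω_Λ x = 0} over subsets Λ ⊆ {1,...,p} of size d-1. Then the packing number of K := K₁ ∩ S^{d-1} at scale 1/2 satisfies, with positive probability over Ω, P(K, 1/2) ≥ (1/√3)·exp(((d-1)/8)·(1 - (d-2)/p)). -/
open MeasureTheory ProbabilityTheory Metric Set
open scoped ENNReal NNReal

/-- The union of the (generically 1-dimensional) subspaces `{x : Ω_Λ x = 0}` over index sets
`Λ ⊆ {1,…,p}` of size `d-1`, for an analysis operator `Ω ∈ ℝ^{p×d}`. -/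
def Kone {p d : ℕ} (Ω : Fin p → Fin d → ℝ) : Set (EuclideanSpace ℝ (Fin d)) :=
  ⋃ Λ ∈ {Λ : Finset (Fin p) | Λ.card = d - 1},
    {x : EuclideanSpace ℝ (Fin d) | ∀ i ∈ Λ, ∑ j, Ω i j * x j = 0}

/-- A Gilbert–Varshamov bound for binary codes whose minimum distance exceeds `m`. -/
theorem exists_binary_code (n m : ℕ) :
    ∃ C : Finset (Fin n → Bool),
      (∀ c ∈ C, ∀ c' ∈ C, c ≠ c' → m < hammingDist c c') ∧
      (2 : ℝ) ^ n * (1 / 2) ^ m ≤ C.card * (3 / 2) ^ n := by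
  classical
  obtain ⟨C, hC⟩ := (Set.toFinite {C : Finset (Fin n → Bool) |
    ∀ c ∈ C, ∀ c' ∈ C, c ≠ c' → m < hammingDist c c'}).exists_maximal ⟨∅, by simp⟩
  simp only [mem_ofPred_eq] at hC
  refine ⟨C, hC.prop, ?_⟩
  have hcover : ∀ y, ∃ c ∈ C, hammingDist c y ≤ m := by
    intro y
    by_contra! h
    have hins := hC.le_of_ge (y := insert y C) ?_ (Finset.subset_insert _ _)
    · have := h y (hins (Finset.mem_insert_self _ _))
      simp at this
    · intro c hc c' hc' hne
      rcases Finset.mem_insert.1 hc with h₁ | h₁ <;>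
        rcases Finset.mem_insert.1 hc' with h₂ | h₂
      · exact absurd (h₁.trans h₂.symm) hne
      · rw [h₁, hammingDist_comm]; exact h _ h₂
      · rw [h₂]; exact h _ h₁
      · exact hC.prop _ h₁ _ h₂ hne
  have hsum : ∀ c : Fin n → Bool,
      ∑ y : Fin n → Bool, (1 / 2 : ℝ) ^ hammingDist c y = (3 / 2) ^ n := by
    intro c
    have hprod : ∀ y : Fin n → Bool,
        (1 / 2 : ℝ) ^ hammingDist c y = ∏ i, if c i ≠ y i then (1 / 2 : ℝ) else 1 := by
      intro y
      rw [Finset.prod_ite]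
      simp [hammingDist]
    simp_rw [hprod]
    have := Finset.prod_univ_sum (fun _ : Fin n => (Finset.univ : Finset Bool))
      (fun i b => if c i ≠ b then (1 / 2 : ℝ) else 1)
    rw [Fintype.piFinset_univ] at this
    rw [← this]
    have h2 : ∀ i, ∑ b : Bool, (if c i ≠ b then (1 / 2 : ℝ) else 1) = 3 / 2 := by
      intro i
      cases c i <;> norm_num
    simp_rw [h2]
    rw [Finset.prod_const, Finset.card_univ, Fintype.card_fin]
  calc (2 : ℝ) ^ n * (1 / 2) ^ m = ∑ _y : Fin n → Bool, (1 / 2 : ℝ) ^ m := by simp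
    _ ≤ ∑ y : Fin n → Bool, ∑ c ∈ C, (1 / 2 : ℝ) ^ hammingDist c y := by
        refine Finset.sum_le_sum fun y _ => ?_
        obtain ⟨c, hc, hcy⟩ := hcover y
        refine le_trans (pow_le_pow_of_le_one (by norm_num) (by norm_num) hcy) ?_
        exact Finset.single_le_sum (f := fun c => (1 / 2 : ℝ) ^ hammingDist c y)
          (fun _ _ => by positivity) hc
    _ = C.card * (3 / 2) ^ n := by
        rw [Finset.sum_comm]
        simp_rw [hsum]
        simp

/-- A kernel vector of a reduced echelon system of `n` equations in `n + 1` unknowns extends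
to a continuous choice of kernel vectors of the perturbed systems. -/
theorem exists_continuous_kernel_vector {n p : ℕ} (Ω₀ : Fin p → Fin (n + 1) → ℝ)
    (r : Fin n → Fin p) (s : Fin (n + 1) → ℝ) (hs : s 0 = 1)
    (hker : ∀ j, ∑ k, Ω₀ (r j) k * s k = 0)
    (hech : ∀ j k, Ω₀ (r j) k.succ = if k = j then 1 else 0) :
    ∃ f : (Fin p → Fin (n + 1) → ℝ) → EuclideanSpace ℝ (Fin (n + 1)),
      Continuous f ∧ f Ω₀ = WithLp.toLp 2 s ∧ ∀ Ω j, ∑ k, Ω (r j) k * f Ω k = 0 := by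
  let M : (Fin p → Fin (n + 1) → ℝ) → Matrix (Fin (n + 1)) (Fin (n + 1)) ℝ :=
    fun Ω => Matrix.of (Fin.cons (Pi.single 0 1) fun j => Ω (r j))
  let e : Fin (n + 1) → ℝ := Pi.single 0 1
  have hM : Continuous M := by
    refine continuous_matrix fun i k => ?_
    refine Fin.cases ?_ (fun j => ?_) i
    · simpa [M] using continuous_const
    · simp only [M, Matrix.of_apply, Fin.cons_succ]
      fun_prop
  have hdet : (M Ω₀).det = 1 := by
    rw [Matrix.det_of_isLowerTriangular]
    · refine Finset.prod_eq_one fun i _ => ?_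
      refine Fin.cases ?_ (fun j => ?_) i
      · simp [M]
      · simp [M, hech]
    · intro i k hik
      replace hik : i < k := hik
      obtain ⟨k, rfl⟩ := Fin.exists_succ_eq.2 (Fin.ne_zero_of_lt hik)
      revert hik
      refine Fin.cases ?_ (fun j => ?_) i
      · simp [M]
      · intro hjk
        have : k ≠ j := by rintro rfl; exact lt_irrefl _ hjk
        simp [M, hech, this]
  refine ⟨fun Ω => WithLp.toLp 2 ((M Ω).adjugate.mulVec e), ?_, ?_, fun Ω j => ?_⟩
  · exact (PiLp.continuous_toLp 2 _).comp (hM.matrix_adjugate.matrix_mulVec continuous_const)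
  · have hMs : (M Ω₀).mulVec s = e := by
      funext i
      refine Fin.cases ?_ (fun j => ?_) i
      · simp [M, Matrix.mulVec, e, hs]
      · simpa [M, Matrix.mulVec, dotProduct, e] using hker j
    beta_reduce
    rw [← hMs, Matrix.mulVec_mulVec, Matrix.adjugate_mul, hdet, one_smul, Matrix.one_mulVec]
  · have h : (M Ω).mulVec ((M Ω).adjugate.mulVec e) = (M Ω).det • e := by
      rw [Matrix.mulVec_mulVec, Matrix.mul_adjugate, Matrix.smul_mulVec, Matrix.one_mulVec]
    have := congrFun h j.succ
    simpa [Matrix.mulVec, dotProduct, M, e] using this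

instance isOpenPosMeasure_gaussianReal_standard : (gaussianReal 0 1).IsOpenPosMeasure :=
  (gaussianReal_absolutelyContinuous' 0 one_ne_zero).isOpenPosMeasure

/-- The vector `(1, ±1, …, ±1)` with signs prescribed by `c`. -/
def signVector {n : ℕ} (c : Fin n → Bool) : Fin (n + 1) → ℝ :=
  Fin.cons 1 fun j => if c j then 1 else -1

theorem norm_sq_signVector {n : ℕ} (c : Fin n → Bool) :
    ‖WithLp.toLp 2 (signVector c)‖ ^ 2 = n + 1 := by
  rw [EuclideanSpace.norm_sq_eq, Fin.sum_univ_succ]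
  have : ∀ j, (if c j then (1 : ℝ) else -1) ^ 2 = 1 := fun j => by split_ifs <;> norm_num
  simp [signVector, this, add_comm]

theorem norm_sq_signVector_sub {n : ℕ} (c c' : Fin n → Bool) :
    ‖WithLp.toLp 2 (signVector c) - WithLp.toLp 2 (signVector c')‖ ^ 2
      = 4 * hammingDist c c' := by
  rw [EuclideanSpace.norm_sq_eq, Fin.sum_univ_succ]
  have : ∀ j, ((if c j then (1 : ℝ) else -1) - if c' j then 1 else -1) ^ 2
      = if c j ≠ c' j then 4 else 0 := fun j => by
    cases c j <;> cases c' j <;> norm_num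
  simp only [signVector, PiLp.sub_apply, Fin.cons_zero, Fin.cons_succ, Real.norm_eq_abs, sq_abs,
    this]
  rw [Finset.sum_ite]
  simp [hammingDist, mul_comm]

/-- The index of the row `x_j = ± x_0` prescribed by the sign `c j`. -/
def signRow {n p : ℕ} (hp : 2 * n ≤ p) (c : Fin n → Bool) (j : Fin n) : Fin p :=
  ⟨2 * j + if c j then 1 else 0, by have := j.2; split_ifs <;> omega⟩

theorem signRow_injective {n p : ℕ} (hp : 2 * n ≤ p) (c : Fin n → Bool) :
    Function.Injective (signRow hp c) := by
  intro j k h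
  simp only [signRow, Fin.mk.injEq] at h
  ext
  split_ifs at h <;> omega

/-- An analysis operator whose rows `2j` and `2j+1` are the equations `x_j = ∓ x_0`. -/
def cubeOperator (n p : ℕ) : Fin p → Fin (n + 1) → ℝ :=
  fun i => Fin.cons (if (i : ℕ) % 2 = 1 then -1 else 1) fun k => if (k : ℕ) = i / 2 then 1 else 0

theorem cubeOperator_signRow_succ {n p : ℕ} (hp : 2 * n ≤ p) (c : Fin n → Bool) (j k : Fin n) :
    cubeOperator n p (signRow hp c j) k.succ = if k = j then 1 else 0 := by
  have : (2 * (j : ℕ) + if c j then 1 else 0) / 2 = j := by split_ifs <;> omega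
  simp [cubeOperator, signRow, this, Fin.ext_iff]

theorem sum_cubeOperator_signRow {n p : ℕ} (hp : 2 * n ≤ p) (c : Fin n → Bool) (j : Fin n) :
    ∑ k, cubeOperator n p (signRow hp c j) k * signVector c k = 0 := by
  rw [Fin.sum_univ_succ]
  simp_rw [cubeOperator_signRow_succ]
  have : (2 * (j : ℕ) + if c j then 1 else 0) % 2 = if c j then 1 else 0 := by
    split_ifs <;> omega
  simp only [cubeOperator, signRow, this, signVector, Fin.cons_zero, Fin.cons_succ]
  simp only [ite_mul, one_mul, zero_mul, Finset.sum_ite_eq', Finset.mem_univ,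
    if_true]
  cases h : c j <;> simp

/-- A normalized sign vector extends to unit vectors of `Kone Ω` depending continuously on `Ω`. -/
theorem exists_continuousAt_unit_mem_Kone {n p : ℕ} (hp : 2 * n ≤ p) (c : Fin n → Bool) :
    ∃ g : (Fin p → Fin (n + 1) → ℝ) → EuclideanSpace ℝ (Fin (n + 1)),
      ContinuousAt g (cubeOperator n p) ∧
      g (cubeOperator n p) = (Real.sqrt (n + 1))⁻¹ • WithLp.toLp 2 (signVector c) ∧
      ∀ᶠ Ω in nhds (cubeOperator n p), g Ω ∈ Kone Ω ∩ sphere 0 1 := by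
  obtain ⟨f, hf, hf₀, hker⟩ := exists_continuous_kernel_vector (cubeOperator n p) (signRow hp c)
    (signVector c) (by simp [signVector]) (sum_cubeOperator_signRow hp c)
    (cubeOperator_signRow_succ hp c)
  have hnorm : ‖f (cubeOperator n p)‖ = Real.sqrt (n + 1) := by
    rw [hf₀, ← norm_sq_signVector c, Real.sqrt_sq (norm_nonneg _)]
  have hne : ‖f (cubeOperator n p)‖ ≠ 0 := by rw [hnorm]; positivity
  refine ⟨fun Ω => ‖f Ω‖⁻¹ • f Ω, ?_, by beta_reduce; rw [hnorm, hf₀], ?_⟩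
  · exact (hf.norm.continuousAt.inv₀ hne).smul hf.continuousAt
  · filter_upwards [hf.norm.continuousAt.eventually_ne hne] with Ω hΩ
    refine ⟨?_, ?_⟩
    · simp only [Kone, mem_iUnion, mem_ofPred_eq, exists_prop]
      refine ⟨Finset.univ.image (signRow hp c), ?_, ?_⟩
      · rw [Finset.card_image_of_injective _ (signRow_injective hp c)]
        simp
      · intro i hi
        obtain ⟨j, -, rfl⟩ := Finset.mem_image.1 hi
        calc ∑ k, Ω (signRow hp c j) k * (‖f Ω‖⁻¹ • f Ω) k
            = ‖f Ω‖⁻¹ * ∑ k, Ω (signRow hp c j) k * f Ω k := by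
              rw [Finset.mul_sum]
              refine Finset.sum_congr rfl fun k _ => ?_
              simp only [PiLp.smul_apply, smul_eq_mul]
              ring
          _ = 0 := by rw [hker, mul_zero]
    · rw [mem_sphere_zero_iff_norm, norm_smul, norm_inv, norm_norm, inv_mul_cancel₀ hΩ]

/-- The numerical form of the Gilbert–Varshamov bound for minimum distance `(n + 1) / 16`. -/
theorem exp_le_of_code_bound {n N : ℕ}
    (h : (2 : ℝ) ^ n * (1 / 2) ^ ((n + 1) / 16) ≤ N * (3 / 2) ^ n) :
    1 / Real.sqrt 3 * Real.exp (n / 8) ≤ N := by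
  have h43 : (4 / 3 : ℝ) ^ n * (1 / 2) ^ ((n + 1) / 16) ≤ N := by
    have h3 : (0 : ℝ) < (3 / 2) ^ n := by positivity
    refine le_of_mul_le_mul_right (le_trans (le_of_eq ?_) h) h3
    rw [mul_right_comm, ← mul_pow]
    norm_num
  refine le_trans ?_ h43
  refine (pow_le_pow_iff_left₀ (by positivity) (by positivity) (n := 16) (by norm_num)).1 ?_
  have hs : (Real.sqrt 3) ^ 16 = 6561 := by
    rw [show (16 : ℕ) = 2 * 8 by norm_num, pow_mul, Real.sq_sqrt (by norm_num)]
    norm_num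
  have he : Real.exp (n / 8) ^ 16 = (Real.exp 1 ^ 2) ^ n := by
    rw [← Real.exp_nat_mul, ← Real.exp_nat_mul, ← Real.exp_nat_mul]
    congr 1
    push_cast
    ring
  have he2 : Real.exp 1 ^ 2 ≤ (4 / 3) ^ 16 * (1 / 2) := by
    have := Real.exp_one_lt_three
    have := Real.exp_pos 1
    nlinarith
  calc (1 / Real.sqrt 3 * Real.exp (n / 8)) ^ 16
      = 1 / 6561 * (Real.exp 1 ^ 2) ^ n := by rw [mul_pow, he, div_pow, hs, one_pow]
    _ ≤ 1 / 2 * ((4 / 3) ^ 16 * (1 / 2)) ^ n := by gcongr; norm_num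
    _ = ((4 / 3) ^ n) ^ 16 * (1 / 2) ^ (n + 1) := by
        rw [mul_pow, ← pow_mul, ← pow_mul, mul_comm 16 n]; ring
    _ ≤ ((4 / 3) ^ n) ^ 16 * (1 / 2) ^ ((n + 1) / 16 * 16) := by
        refine mul_le_mul_of_nonneg_left ?_ (by positivity)
        exact pow_le_pow_of_le_one (by norm_num) (by norm_num) (Nat.div_mul_le_self _ _)
    _ = ((4 / 3) ^ n * (1 / 2) ^ ((n + 1) / 16)) ^ 16 := by rw [mul_pow, pow_mul (1 / 2 : ℝ)]

/-- for `Ω ∈ ℝ^{p×d}` with i.i.d. standard Gaussian entries and `p ≥ 2(d-1)`,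
with positive probability over `Ω` there is a `1/2`-packing of `K₁ ∩ S^{d-1}` of cardinality
at least `(1/√3)·exp(((d-1)/8)(1-(d-2)/p))`. -/
theorem stmt5 (p d : ℕ) (hd : 1 ≤ d) (hp : 2 * (d - 1) ≤ p) :
    (Measure.pi fun _ : Fin p => Measure.pi fun _ : Fin d => gaussianReal 0 1)
      {Ω : Fin p → Fin d → ℝ |
        ∃ X : Finset (EuclideanSpace ℝ (Fin d)),
          ↑X ⊆ Kone Ω ∩ sphere (0 : EuclideanSpace ℝ (Fin d)) 1 ∧
          (1 / Real.sqrt 3) * Real.exp (((d : ℝ) - 1) / 8 * (1 - ((d : ℝ) - 2) / p))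
            ≤ (X.card : ℝ) ∧
          ∀ x ∈ X, ∀ y ∈ X, x ≠ y → (1 / 2 : ℝ) ≤ ‖x - y‖} ≠ 0 := by
  classical
  obtain ⟨n, rfl⟩ : ∃ n, d = n + 1 := ⟨d - 1, by omega⟩
  replace hp : 2 * n ≤ p := hp
  obtain ⟨C, hsep, hcard⟩ := exists_binary_code n ((n + 1) / 16)
  choose g hcont hg₀ hmem using exists_continuousAt_unit_mem_Kone hp
  have hfar : ∀ c ∈ C, ∀ c' ∈ C, c ≠ c' →
      ∀ᶠ Ω in nhds (cubeOperator n p), 1 / 2 < ‖g c Ω - g c' Ω‖ := by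
    intro c hc c' hc' hne
    refine ((hcont c).sub (hcont c')).norm.eventually_const_lt ?_
    have hn : (0 : ℝ) < n + 1 := by positivity
    have h16 : (n : ℝ) + 1 < 16 * hammingDist c c' := by
      have := hsep c hc c' hc' hne
      have : n + 1 < 16 * hammingDist c c' := by omega
      exact_mod_cast this
    refine lt_of_pow_lt_pow_left₀ 2 (norm_nonneg _) ?_
    simp only [Pi.sub_apply]
    rw [hg₀, hg₀, ← smul_sub, norm_smul, mul_pow, norm_sq_signVector_sub, Real.norm_eq_abs, sq_abs,
      inv_pow, Real.sq_sqrt hn.le, ← div_eq_inv_mul, lt_div_iff₀ hn]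
    linarith
  have hev : ∀ᶠ Ω in nhds (cubeOperator n p),
      (∀ c ∈ C, g c Ω ∈ Kone Ω ∩ sphere 0 1) ∧
      ∀ c ∈ C, ∀ c' ∈ C, c ≠ c' → 1 / 2 < ‖g c Ω - g c' Ω‖ := by
    refine Filter.Eventually.and ?_ ?_
    · exact (Filter.eventually_all_finset C).2 fun c _ => hmem c
    · refine (Filter.eventually_all_finset C).2 fun c hc =>
        (Filter.eventually_all_finset C).2 fun c' hc' => ?_
      by_cases hne : c = c'
      · exact Filter.Eventually.of_forall fun _ h => absurd hne h
      · exact (hfar c hc c' hc' hne).mono fun _ h _ => h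
  have : (Measure.pi fun _ : Fin (n + 1) => gaussianReal 0 1).IsOpenPosMeasure :=
    Measure.pi.isOpenPosMeasure _
  have : (Measure.pi fun _ : Fin p =>
      Measure.pi fun _ : Fin (n + 1) => gaussianReal 0 1).IsOpenPosMeasure :=
    Measure.pi.isOpenPosMeasure _
  refine (Measure.measure_pos_of_mem_nhds _ (x := cubeOperator n p) ?_).ne'
  filter_upwards [hev] with Ω ⟨hK, hd⟩
  have hinj : Set.InjOn (fun c => g c Ω) C := by
    intro c hc c' hc' heq
    by_contra hne
    have := hd c hc c' hc' hne
    rw [show g c Ω = g c' Ω from heq, sub_self, norm_zero] at this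
    norm_num at this
  refine ⟨C.image fun c => g c Ω, ?_, ?_, ?_⟩
  · intro x hx
    obtain ⟨c, hc, rfl⟩ := Finset.mem_image.1 (Finset.mem_coe.1 hx)
    exact hK c hc
  · rw [Finset.card_image_of_injOn hinj]
    refine le_trans ?_ (exp_le_of_code_bound hcard)
    gcongr
    push_cast
    rw [add_sub_cancel_right, div_eq_mul_one_div (n : ℝ) 8, mul_one_div]
    rcases Nat.eq_zero_or_pos n with rfl | hn
    · simp
    · have hn1 : (1 : ℝ) ≤ n := by exact_mod_cast hn
      have : 0 ≤ ((n : ℝ) + 1 - 2) / p := div_nonneg (by linarith) (by positivity)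
      exact mul_le_of_le_one_right (by positivity) (by linarith)
  · intro x hx y hy hne
    obtain ⟨c, hc, rfl⟩ := Finset.mem_image.1 hx
    obtain ⟨c', hc', rfl⟩ := Finset.mem_image.1 hy
    exact (hd c hc c' hc' fun h => hne (by rw [h])).le
end
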